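/- Suppose that α = (a_1, ..., a_n) and α' = (a_1', ..., a_n') are zero-sum-free sequences of elements of an abelian group that are rearrangements (permutations) of each other. If both α and α' are sharp, then their last terms coincide: a_n = a_n'. -/

import Mathlib

/-- The set of all subsequence sums of a list (including the sum 0 of the empty
subsequence). -/
def subSums {G : Type*} [AddCommMonoid G] [DecidableEq G] (l : List G) : Finset G :=
  (l.sublists.map List.sum).toFinset

/-- A sequence is zero-sum-free if no nonempty subsequence sums to zero. -/
def ZeroSumFree {G : Type*} [AddCommMonoid G] (l : List G) : Prop :=
  ∀ t : List G, t.Sublist l → t ≠ [] → t.sum ≠ 0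

/-- A sequence `α` of length `n` is sharp if `Σ(α) = Σ(α_{n-1}) ∪ {σ(α)}`. -/
def IsSharp {G : Type*} [AddCommMonoid G] [DecidableEq G] (l : List G) : Prop :=
  subSums l = subSums l.dropLast ∪ {l.sum}

theorem mem_subSums {G : Type*} [AddCommMonoid G] [DecidableEq G] {l : List G} {a : G} :
    a ∈ subSums l ↔ ∃ t : List G, t.Sublist l ∧ t.sum = a := by
  simp [subSums]

theorem List.Sublist.exists_compl_sum {G : Type*} [AddCommMonoid G] {t l : List G}
    (h : t.Sublist l) : ∃ u : List G, u.Sublist l ∧ t.sum + u.sum = l.sum := by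
  induction h with
  | slnil => exact ⟨[], .slnil, by simp⟩
  | cons a _ ih =>
    obtain ⟨u, hu, hsum⟩ := ih
    exact ⟨a :: u, hu.cons_cons a, by rw [List.sum_cons, List.sum_cons, ← hsum, add_left_comm]⟩
  | cons_cons a _ ih =>
    obtain ⟨u, hu, hsum⟩ := ih
    exact ⟨u, hu.cons a, by rw [List.sum_cons, List.sum_cons, ← hsum, add_assoc]⟩

theorem sum_sub_mem_subSums {G : Type*} [AddCommGroup G] [DecidableEq G] {l : List G} {a : G}
    (ha : a ∈ subSums l) : l.sum - a ∈ subSums l := by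
  obtain ⟨t, ht, rfl⟩ := mem_subSums.1 ha
  obtain ⟨u, hu, hsum⟩ := ht.exists_compl_sum
  exact mem_subSums.2 ⟨u, hu, by rw [← hsum, add_sub_cancel_left]⟩

theorem sum_mem_subSums {G : Type*} [AddCommMonoid G] [DecidableEq G] (l : List G) :
    l.sum ∈ subSums l :=
  mem_subSums.2 ⟨l, .refl l, rfl⟩

theorem add_mem_subSums_append {G : Type*} [AddCommMonoid G] [DecidableEq G] {l : List G} {a : G}
    (c : G) (ha : a ∈ subSums l) : a + c ∈ subSums (l ++ [c]) := by
  obtain ⟨t, ht, rfl⟩ := mem_subSums.1 ha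
  exact mem_subSums.2 ⟨t ++ [c], ht.append (.refl _), by simp⟩

theorem List.Perm.subSums_eq {G : Type*} [AddCommMonoid G] [DecidableEq G] {l l' : List G}
    (h : l.Perm l') : subSums l = subSums l' := by
  have key : ∀ {l l' : List G}, l.Perm l' → subSums l ⊆ subSums l' := by
    intro l l' h a ha
    obtain ⟨t, ht, rfl⟩ := mem_subSums.1 ha
    obtain ⟨u, hut, hu⟩ := ht.subperm.trans h.subperm
    exact mem_subSums.2 ⟨u, hu, hut.sum_eq⟩
  exact (key h).antisymm (key h.symm)

theorem ZeroSumFree.sum_notMem_subSums {G : Type*} [AddCommGroup G] [DecidableEq G] {l : List G}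
    {c : G} (h : ZeroSumFree (l ++ [c])) : (l ++ [c]).sum ∉ subSums l := by
  intro hmem
  obtain ⟨u, hu, hsum⟩ := mem_subSums.1 (sum_sub_mem_subSums hmem)
  refine h (u ++ [c]) (hu.append (.refl _)) (by simp) ?_
  simp [hsum]

theorem IsSharp.subSums_eq_erase {G : Type*} [AddCommGroup G] [DecidableEq G] {l : List G} {c : G}
    (hs : IsSharp (l ++ [c])) (h : ZeroSumFree (l ++ [c])) :
    subSums l = (subSums (l ++ [c])).erase (l ++ [c]).sum := by
  have hn := h.sum_notMem_subSums
  rw [IsSharp, List.dropLast_concat] at hs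
  rw [hs, Finset.union_singleton, Finset.erase_insert hn]

/-- **Claim.** If the zero-sum-free sequences `α = l ++ [c]` and `α' = l' ++ [c']` are
rearrangements of each other and both are sharp, then their last terms coincide:
`c = c'`. -/
theorem sharp_last_term_eq {G : Type*} [AddCommGroup G] [DecidableEq G]
    (l l' : List G) (c c' : G)
    (hperm : (l ++ [c]).Perm (l' ++ [c']))
    (hzsf : ZeroSumFree (l ++ [c])) (hzsf' : ZeroSumFree (l' ++ [c']))
    (hsharp : IsSharp (l ++ [c])) (hsharp' : IsSharp (l' ++ [c'])) :
    c = c' := by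
  have hsum := hperm.sum_eq
  have heq : subSums l = subSums l' := by
    rw [hsharp.subSums_eq_erase hzsf, hsharp'.subSums_eq_erase hzsf', hperm.subSums_eq, hsum]
  have hmem : l'.sum + c ∈ subSums (l ++ [c]) :=
    add_mem_subSums_append c (heq ▸ sum_mem_subSums l')
  by_cases ht : l'.sum + c = (l ++ [c]).sum
  · rw [hsum] at ht
    simpa using ht
  · have h₁ : l'.sum + c ∈ subSums l := by
      rw [hsharp.subSums_eq_erase hzsf]
      exact Finset.mem_erase.2 ⟨ht, hmem⟩
    have h₂ := sum_sub_mem_subSums (heq ▸ h₁)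
    rw [← heq] at h₂
    have h₃ := sum_sub_mem_subSums h₂
    refine absurd ?_ hzsf.sum_notMem_subSums
    convert h₃ using 1
    simp
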